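/- There is an absolute constant M₀ such that for every real M ≥ M₀ the following holds. Let n ≥ s + t + 110, let f : F_q^n → F_q, and suppose μ(S_t) ≤ q^{−M}. Then for every a ∈ F_q^{s+t} with a ∉ supp(H) and every b ∈ F_q^n, the density of S_t in the zoom-in C_{a,b} is strictly less than 1 − 1/(q−1)² − 1/q⁶ − 2000·t·q^{200}·q^{−M/4}. -/

import Mathlib

noncomputable section

open Finset

/-- Affine maps `F^ℓ → F^n`, given as a pair (linear part matrix, translation). -/
abbrev Aff (F : Type) (n ℓ : ℕ) := Matrix (Fin n) (Fin ℓ) F × (Fin n → F)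

/-- Application of an affine map `T = (M, c)`: `x ↦ Mx + c`. -/
def affApp {F : Type} [Field F] {n ℓ : ℕ} (T : Aff F n ℓ) (x : Fin ℓ → F) : Fin n → F :=
  T.1.mulVec x + T.2

/-- Inner product of two functions `F^m → F`. -/
def ip {F : Type} [Field F] [Fintype F] {m : ℕ} (u v : (Fin m → F) → F) : F :=
  ∑ z : Fin m → F, u z * v z

/-- `g` has degree at most `d` as a function. -/
def fDegLE {F : Type} [Field F] {m : ℕ} (g : (Fin m → F) → F) (d : ℕ) : Prop :=
  ∃ Q : MvPolynomial (Fin m) F, Q.totalDegree ≤ d ∧ ∀ x, MvPolynomial.eval x Q = g x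

/-- The defining equation of the polynomial `P`:
`x_1 ⋯ x_{p-1} · P = ∑_{I ⊆ [p-1]} (-1)^{|I|+1} (x_I + x_p)^{q-1}`. -/
def Pdef {F : Type} [Field F] (p q : ℕ) (hp : 0 < p) (P : MvPolynomial (Fin p) F) : Prop :=
  (∏ i : Fin (p - 1), MvPolynomial.X (Fin.castLE (Nat.sub_le p 1) i)) * P =
    ∑ I : Finset (Fin (p - 1)),
      MvPolynomial.C ((-1 : F) ^ (I.card + 1)) *
        ((∑ i ∈ I, MvPolynomial.X (Fin.castLE (Nat.sub_le p 1) i)) +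
          MvPolynomial.X (⟨p - 1, Nat.sub_lt hp one_pos⟩ : Fin p)) ^ (q - 1)

/-- The test polynomial `H_e` as a function on `F^{s+t}`. -/
def Hfun {F : Type} [Field F] {p : ℕ} (P : MvPolynomial (Fin p) F)
    (s t : ℕ) (e : Fin t → ℕ) (x : Fin (s + t) → F) : F :=
  (∏ i ∈ Finset.range (s / p),
    MvPolynomial.eval (fun l : Fin p =>
      if h : p * i + (l : ℕ) < s + t then x ⟨p * i + (l : ℕ), h⟩ else 0) P) *
  ∏ j : Fin t, x (Fin.natAdd s j) ^ e j

/-- A degree sequence `e ∈ {0, …, q-1}^t` is valid if `∑ e_j ≤ t(q-1) - r`. -/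
def validE (q r t : ℕ) (e : Fin t → ℕ) : Prop :=
  (∀ j, e j ≤ q - 1) ∧ ∑ j, e j ≤ t * (q - 1) - r

/-- `T` rejects `f` in the sparse `(s+t)`-flat test. -/
def rejects {F : Type} [Field F] [Fintype F] {p : ℕ} (P : MvPolynomial (Fin p) F)
    (q s r t n : ℕ) (f : (Fin n → F) → F) (T : Aff F n (s + t)) : Prop :=
  ∃ e : Fin t → ℕ, validE q r t e ∧ ip (fun x => f (affApp T x)) (Hfun P s t e) ≠ 0

/-- Density of `A` inside `C`. -/
def dens {α : Type} (A C : Set α) : ℝ :=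
  (Nat.card ↥(A ∩ C) : ℝ) / (Nat.card ↥C : ℝ)

/-- Fractional measure of a set in a (finite) type. -/
def mu {α : Type} (A : Set α) : ℝ :=
  (Nat.card ↥A : ℝ) / (Nat.card α : ℝ)

/-- The union of the supports of the test polynomials `H_e`. -/
def suppH {F : Type} [Field F] [Fintype F] {p : ℕ} (P : MvPolynomial (Fin p) F)
    (q s t : ℕ) : Set (Fin (s + t) → F) :=
  {x | ∃ e : Fin t → ℕ, (∀ j, e j ≤ q - 1) ∧ Hfun P s t e x ≠ 0}

/-- Edge expansion of a set `S` in the (regular) graph with adjacency `adj`: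
the probability that a uniformly random step started in `S` escapes `S`. -/
def expans {α : Type} (adj : α → α → Prop) (S : Set α) : ℝ :=
  (Nat.card {x : α × α // x.1 ∈ S ∧ adj x.1 x.2 ∧ x.2 ∉ S} : ℝ) /
  (Nat.card {x : α × α // x.1 ∈ S ∧ adj x.1 x.2} : ℝ)

/-- Adjacency in the affine bi-linear scheme graph: two distinct affine maps are adjacent
iff their agreement set is an affine subspace of dimension `ℓ - 1`. -/
def adjBilin {F : Type} [Field F] {n ℓ : ℕ} (T₁ T₂ : Aff F n ℓ) : Prop :=
  T₁ ≠ T₂ ∧ ∃ W : AffineSubspace F (Fin ℓ → F),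
    (W : Set (Fin ℓ → F)).Nonempty ∧
    (W : Set (Fin ℓ → F)) = {x | affApp T₁ x = affApp T₂ x} ∧
    Module.finrank F W.direction = ℓ - 1

/-- `W` is an `ℓ`-flat: a nonempty affine subspace of dimension `ℓ`. -/
def IsFlat {F : Type} [Field F] {N : ℕ} (ℓ : ℕ) (W : AffineSubspace F (Fin N → F)) : Prop :=
  (W : Set (Fin N → F)).Nonempty ∧ Module.finrank F W.direction = ℓ

/-- Adjacency in the affine Grassmann graph `AffGras(N, ℓ)`: two distinct `ℓ`-flats are
adjacent iff their intersection is an `(ℓ-1)`-flat. -/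
def adjGras {F : Type} [Field F] {N : ℕ} (ℓ : ℕ) (U V : AffineSubspace F (Fin N → F)) : Prop :=
  U ≠ V ∧ IsFlat ℓ U ∧ IsFlat ℓ V ∧ IsFlat (ℓ - 1) (U ⊓ V)

/-- The minimal fractional Hamming distance from `f` to a function of degree at most `d`. -/
def deltaDist {F : Type} [Field F] [Fintype F] {n : ℕ} (f : (Fin n → F) → F) (d : ℕ) : ℝ :=
  sInf {x : ℝ | ∃ g : (Fin n → F) → F, fDegLE g d ∧
    x = (Nat.card {y : Fin n → F // f y ≠ g y} : ℝ) / (Fintype.card (Fin n → F) : ℝ)}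

theorem affApp_shift {F : Type} [Field F] {n m : ℕ} (L : Matrix (Fin n) (Fin m) F)
    (c : Fin n → F) (a x : Fin m → F) :
    affApp (L, c - L.mulVec a) x = c + L.mulVec (x - a) := by
  simp only [affApp, Matrix.mulVec_sub]
  abel

section Counting

variable {F V : Type*} [Field F] [AddCommGroup V] {n m : ℕ}

/-- The matrix obtained from `U` by erasing all columns outside `J`. -/
def colMask (J : Finset (Fin m)) (U : Matrix (Fin n) (Fin m) F) : Matrix (Fin n) (Fin m) F :=
  Matrix.of fun i j => if j ∈ J then U i j else 0

/-- The matrix obtained from `L` by scaling the columns in `J` by `c`. -/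
def colScale (J : Finset (Fin m)) (c : F) (L : Matrix (Fin n) (Fin m) F) :
    Matrix (Fin n) (Fin m) F :=
  Matrix.of fun i j => if j ∈ J then c * L i j else L i j

theorem colMask_add (J : Finset (Fin m)) (U U' : Matrix (Fin n) (Fin m) F) :
    colMask J (U + U') = colMask J U + colMask J U' := by
  ext i j; by_cases h : j ∈ J <;> simp [colMask, h]

theorem colMask_insert {J : Finset (Fin m)} {j : Fin m} (hj : j ∉ J)
    (U : Matrix (Fin n) (Fin m) F) : colMask (insert j J) U = colMask J U + colMask {j} U := by
  ext i j'
  by_cases h : j' = j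
  · subst h; simp [colMask, hj]
  · simp [colMask, h]

theorem colScale_add_colMask (J : Finset (Fin m)) (c : F) (L U : Matrix (Fin n) (Fin m) F) :
    colScale J c L + colMask J (L + U - colScale J c L) = L + colMask J U := by
  ext i j; by_cases h : j ∈ J <;> simp [colMask, colScale, h]

theorem colScale_injective (J : Finset (Fin m)) {c : F} (hc : c ≠ 0) :
    Function.Injective (colScale (n := n) J c) := by
  intro L L' h
  ext i j
  have := congrFun (congrFun h i) j
  by_cases hj : j ∈ J <;> simpa [colScale, hj, hc] using this

variable [Fintype F]

open Classical in
/-- Shearing the first factor by a masked copy of the second one does not change counts. -/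
theorem card_shear_le (J : Finset (Fin m))
    (p : Matrix (Fin n) (Fin m) F → Matrix (Fin n) (Fin m) F → Prop) :
    #{x : Matrix (Fin n) (Fin m) F × Matrix (Fin n) (Fin m) F | p (x.1 + colMask J x.2) x.2} ≤
      #{x : Matrix (Fin n) (Fin m) F × Matrix (Fin n) (Fin m) F | p x.1 x.2} := by
  refine Finset.card_le_card_of_injOn (fun x => (x.1 + colMask J x.2, x.2)) ?_ ?_
  · intro x hx; simpa using hx
  · rintro ⟨x, u⟩ - ⟨y, w⟩ - h
    obtain ⟨h₁, rfl⟩ := Prod.mk.inj h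
    simpa using h₁

open Classical in
theorem card_translate_mul_le (b : Fin n → F) {z : F} (hz : z ≠ 0) (j : Fin m)
    (p : Matrix (Fin n) (Fin m) F → (Fin n → F) → Prop) :
    #{x : Matrix (Fin n) (Fin m) F × Matrix (Fin n) (Fin m) F | p x.1 (b + z • x.2.col j)} *
        Fintype.card (Fin n → F) ≤
      #{x : Matrix (Fin n) (Fin m) F × (Fin n → F) | p x.1 x.2} *
        Fintype.card (Matrix (Fin n) (Fin m) F) := by
  rw [← Finset.card_univ, ← Finset.card_univ, ← Finset.card_product, ← Finset.card_product]
  refine Finset.card_le_card_of_injOn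
    (fun x => ((x.1.1, b + z • x.1.2.col j), x.1.2.updateCol j x.2)) ?_ ?_
  · rintro ⟨⟨L, U⟩, w⟩ hx; simpa using hx
  · rintro ⟨⟨L, U⟩, w⟩ - ⟨⟨L', U'⟩, w'⟩ - h
    obtain ⟨h₁, h₂⟩ := Prod.mk.inj h
    obtain ⟨rfl, h₃⟩ := Prod.mk.inj h₁
    have h₄ : U.col j = U'.col j := by
      have := add_left_cancel h₃
      exact smul_right_injective _ hz this
    have h₅ : w = w' := by
      funext i
      simpa using congrFun (congrFun h₂ i) j
    have h₆ : U = U' := by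
      ext i k
      by_cases hk : k = j
      · subst hk; exact congrFun h₄ i
      · simpa [Matrix.updateCol_apply, hk] using congrFun (congrFun h₂ i) k
    simp [h₅, h₆]

variable (Φ : Matrix (Fin n) (Fin m) F → (Fin n → F) → V) (b : Fin n → F)

open Classical in
/-- If the sums of `Φ` along lines through `b` are insensitive to the `j`-th column, then so are
most values of `Φ` at `b`. -/
theorem card_ne_colMask_singleton_le (j : Fin m)
    (hline : ∀ L U, ∑ z : F, Φ L (b + z • U.col j) =
      ∑ z : F, Φ (L + colMask {j} U) (b + z • U.col j)) :
    #{x : Matrix (Fin n) (Fin m) F × Matrix (Fin n) (Fin m) F |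
        Φ x.1 b ≠ Φ (x.1 + colMask {j} x.2) b} * Fintype.card (Fin n → F) ≤
      2 * Fintype.card F * #{x : Matrix (Fin n) (Fin m) F × (Fin n → F) | Φ x.1 x.2 ≠ 0} *
        Fintype.card (Matrix (Fin n) (Fin m) F) := by
  set A : F → Finset (Matrix (Fin n) (Fin m) F × Matrix (Fin n) (Fin m) F) :=
    fun z => {x | Φ x.1 (b + z • x.2.col j) ≠ 0} with hA
  set A' : F → Finset (Matrix (Fin n) (Fin m) F × Matrix (Fin n) (Fin m) F) :=
    fun z => {x | Φ (x.1 + colMask {j} x.2) (b + z • x.2.col j) ≠ 0} with hA'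
  have hsub : ({x : Matrix (Fin n) (Fin m) F × Matrix (Fin n) (Fin m) F |
        Φ x.1 b ≠ Φ (x.1 + colMask {j} x.2) b} : Finset _) ⊆
      (Finset.univ.erase (0 : F)).biUnion fun z => A z ∪ A' z := by
    rintro ⟨L, U⟩ hx
    by_contra hcon
    simp only [hA, hA', mem_biUnion, mem_erase, mem_univ, and_true, mem_union, mem_filter,
      true_and, not_exists, not_and, not_or, not_not] at hcon hx
    refine hx ?_
    have h := hline L U
    rw [← Finset.add_sum_erase _ _ (mem_univ (0 : F)),
      ← Finset.add_sum_erase _ _ (mem_univ (0 : F)),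
      Finset.sum_eq_zero fun z hz => (hcon z (by simpa using hz)).1,
      Finset.sum_eq_zero fun z hz => (hcon z (by simpa using hz)).2] at h
    simpa using h
  set N := #{x : Matrix (Fin n) (Fin m) F × (Fin n → F) | Φ x.1 x.2 ≠ 0} *
    Fintype.card (Matrix (Fin n) (Fin m) F) with hN
  have hbound : ∀ z ∈ Finset.univ.erase (0 : F),
      #(A z ∪ A' z) * Fintype.card (Fin n → F) ≤ 2 * N := by
    intro z hz
    have h₁ := card_translate_mul_le b (by simpa using hz : z ≠ 0) j (fun L c => Φ L c ≠ 0)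
    have h₂ : #(A' z) ≤ #(A z) := by
      convert card_shear_le {j} (fun L U => Φ L (b + z • U.col j) ≠ 0)
    calc #(A z ∪ A' z) * Fintype.card (Fin n → F)
        ≤ (#(A z) + #(A z)) * Fintype.card (Fin n → F) := by
          gcongr
          exact (Finset.card_union_le _ _).trans (by lia)
      _ ≤ 2 * N := by rw [add_mul]; lia
  calc _ ≤ (∑ z ∈ Finset.univ.erase (0 : F), #(A z ∪ A' z)) * Fintype.card (Fin n → F) := by
        gcongr
        exact (Finset.card_le_card hsub).trans Finset.card_biUnion_le
    _ ≤ ∑ z ∈ Finset.univ.erase (0 : F), 2 * N := by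
        rw [Finset.sum_mul]; exact Finset.sum_le_sum hbound
    _ ≤ ∑ z : F, 2 * N := Finset.sum_le_sum_of_subset (Finset.erase_subset _ _)
    _ = _ := by simp [hN, Finset.card_univ]; ring

open Classical in
theorem card_ne_colMask_le (J : Finset (Fin m))
    (hline : ∀ j ∈ J, ∀ L U, ∑ z : F, Φ L (b + z • U.col j) =
      ∑ z : F, Φ (L + colMask {j} U) (b + z • U.col j)) :
    #{x : Matrix (Fin n) (Fin m) F × Matrix (Fin n) (Fin m) F |
        Φ x.1 b ≠ Φ (x.1 + colMask J x.2) b} * Fintype.card (Fin n → F) ≤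
      #J * (2 * Fintype.card F *
        #{x : Matrix (Fin n) (Fin m) F × (Fin n → F) | Φ x.1 x.2 ≠ 0} *
        Fintype.card (Matrix (Fin n) (Fin m) F)) := by
  induction J using Finset.induction_on with
  | empty =>
    have : ∀ U : Matrix (Fin n) (Fin m) F, colMask ∅ U = 0 := fun U => by ext; simp [colMask]
    simp [this]
  | insert j J hj ih =>
    have ih' := ih fun i hi => hline i (Finset.mem_insert_of_mem hi)
    have hs := card_ne_colMask_singleton_le Φ b j (hline j (Finset.mem_insert_self _ _))
    have hshear := card_shear_le J (fun (L U : Matrix (Fin n) (Fin m) F) =>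
      Φ L b ≠ Φ (L + colMask {j} U) b)
    have hsub : #{x : Matrix (Fin n) (Fin m) F × Matrix (Fin n) (Fin m) F |
          Φ x.1 b ≠ Φ (x.1 + colMask (insert j J) x.2) b} ≤
        #{x : Matrix (Fin n) (Fin m) F × Matrix (Fin n) (Fin m) F |
          Φ x.1 b ≠ Φ (x.1 + colMask J x.2) b} +
        #{x : Matrix (Fin n) (Fin m) F × Matrix (Fin n) (Fin m) F |
          Φ (x.1 + colMask J x.2) b ≠ Φ (x.1 + colMask J x.2 + colMask {j} x.2) b} := by
      refine (Finset.card_le_card ?_).trans (Finset.card_union_le _ _)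
      intro x hx
      simp only [mem_filter, mem_univ, true_and, mem_union, colMask_insert hj] at hx ⊢
      by_contra! hcon
      exact hx (by rw [hcon.1, hcon.2, add_assoc])
    rw [Finset.card_insert_of_notMem hj, add_mul, one_mul]
    calc _ ≤ _ := Nat.mul_le_mul_right _ (hsub.trans (Nat.add_le_add_left (by convert hshear) _))
      _ ≤ _ := by rw [add_mul]; exact Nat.add_le_add ih' (by convert hs)

open Classical in
/-- If moreover the values of `Φ` at `b` over all nonzero scalings of the columns in `J` sum
to zero, then `Φ` vanishes at `b` for most matrices. -/
theorem card_ne_zero_le [Module F V] (J : Finset (Fin m))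
    (hline : ∀ j ∈ J, ∀ L U, ∑ z : F, Φ L (b + z • U.col j) =
      ∑ z : F, Φ (L + colMask {j} U) (b + z • U.col j))
    (hscale : ∀ L, ∑ c ∈ Finset.univ.erase (0 : F), Φ (colScale J c L) b = 0) :
    #{L : Matrix (Fin n) (Fin m) F | Φ L b ≠ 0} * Fintype.card (Fin n → F) ≤
      2 * #J * Fintype.card F ^ 2 *
        #{x : Matrix (Fin n) (Fin m) F × (Fin n → F) | Φ x.1 x.2 ≠ 0} := by
  set K := Fintype.card (Matrix (Fin n) (Fin m) F) with hK
  set N := #{x : Matrix (Fin n) (Fin m) F × (Fin n → F) | Φ x.1 x.2 ≠ 0} with hN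
  set A : F → Finset (Matrix (Fin n) (Fin m) F × Matrix (Fin n) (Fin m) F) :=
    fun c => {x | Φ (colScale J c x.1) b ≠ Φ (x.1 + colMask J x.2) b} with hA
  have hAcard : ∀ c ∈ Finset.univ.erase (0 : F),
      #(A c) * Fintype.card (Fin n → F) ≤ #J * (2 * Fintype.card F * N * K) := by
    intro c hc
    refine le_trans (Nat.mul_le_mul_right _ ?_) (card_ne_colMask_le Φ b J hline)
    refine Finset.card_le_card_of_injOn
      (fun x => (colScale J c x.1, x.1 + x.2 - colScale J c x.1)) ?_ ?_
    · intro x hx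
      simpa [hA, colScale_add_colMask] using hx
    · rintro ⟨L, U⟩ - ⟨L', U'⟩ - h
      obtain ⟨h₁, h₂⟩ := Prod.mk.inj h
      obtain rfl := colScale_injective J (by simpa using hc) h₁
      simpa using h₂
  have hsub : ({x : Matrix (Fin n) (Fin m) F × Matrix (Fin n) (Fin m) F |
      Φ (x.1 + colMask J x.2) b ≠ 0} : Finset _) ⊆ (Finset.univ.erase (0 : F)).biUnion A := by
    rintro ⟨L, U⟩ hx
    by_contra hcon
    simp only [hA, mem_biUnion, mem_erase, mem_univ, and_true, mem_filter,
      true_and, not_exists, not_and, not_not] at hcon hx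
    refine hx ?_
    have h := hscale L
    rw [Finset.sum_congr rfl fun c hc => hcon c (by simpa using hc), Finset.sum_const,
      Finset.card_erase_of_mem (mem_univ _), Finset.card_univ, ← Nat.cast_smul_eq_nsmul F,
      Nat.cast_sub Fintype.card_pos] at h
    simpa using h
  have hfull : #{L : Matrix (Fin n) (Fin m) F | Φ L b ≠ 0} * K ≤
      #{x : Matrix (Fin n) (Fin m) F × Matrix (Fin n) (Fin m) F |
        Φ (x.1 + colMask J x.2) b ≠ 0} := by
    rw [hK, ← Finset.card_univ, ← Finset.card_product]
    refine Finset.card_le_card_of_injOn (fun x => (x.1 - colMask J x.2, x.2)) ?_ ?_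
    · intro x hx; simpa using hx
    · rintro ⟨x, u⟩ - ⟨y, w⟩ - h
      obtain ⟨h₁, rfl⟩ := Prod.mk.inj h
      simpa using h₁
  have hKpos : 0 < K := Fintype.card_pos
  refine Nat.le_of_mul_le_mul_right ?_ hKpos
  calc _ = #{L : Matrix (Fin n) (Fin m) F | Φ L b ≠ 0} * K * Fintype.card (Fin n → F) := by ring
    _ ≤ (∑ c ∈ Finset.univ.erase (0 : F), #(A c)) * Fintype.card (Fin n → F) := by
        gcongr
        exact hfull.trans ((Finset.card_le_card hsub).trans Finset.card_biUnion_le)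
    _ ≤ ∑ c ∈ Finset.univ.erase (0 : F), #J * (2 * Fintype.card F * N * K) := by
        rw [Finset.sum_mul]; exact Finset.sum_le_sum hAcard
    _ ≤ ∑ c : F, #J * (2 * Fintype.card F * N * K) :=
        Finset.sum_le_sum_of_subset (Finset.erase_subset _ _)
    _ = _ := by simp [Finset.card_univ]; ring

end Counting

section TestPolynomial

variable {F : Type} [Field F]

theorem Pdef.totalDegree_add_le {p q : ℕ} {hp : 0 < p} {P : MvPolynomial (Fin p) F}
    (hP : Pdef p q hp P) (hP₀ : P ≠ 0) : (p - 1) + P.totalDegree ≤ q - 1 := by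
  have hX : ∀ i : Fin (p - 1), (MvPolynomial.X (Fin.castLE (Nat.sub_le p 1) i) :
      MvPolynomial (Fin p) F) ≠ 0 := fun i => MvPolynomial.X_ne_zero _
  have hprod : ∀ S : Finset (Fin (p - 1)),
      (∏ i ∈ S, (MvPolynomial.X (Fin.castLE (Nat.sub_le p 1) i) :
        MvPolynomial (Fin p) F)).totalDegree = #S := by
    intro S
    induction S using Finset.induction_on with
    | empty => simp
    | insert i S hi ih =>
      rw [Finset.prod_insert hi, MvPolynomial.totalDegree_mul_of_isDomain (hX i)
        (Finset.prod_ne_zero_iff.2 fun j _ => hX j), ih, MvPolynomial.totalDegree_X,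
        Finset.card_insert_of_notMem hi, add_comm]
  have h := congrArg MvPolynomial.totalDegree hP
  rw [MvPolynomial.totalDegree_mul_of_isDomain (Finset.prod_ne_zero_iff.2 fun j _ => hX j) hP₀,
    hprod, Finset.card_univ, Fintype.card_fin] at h
  rw [h]
  refine MvPolynomial.totalDegree_finsetSum_le fun I _ => ?_
  refine (MvPolynomial.totalDegree_mul _ _).trans ?_
  rw [MvPolynomial.totalDegree_C, zero_add]
  refine (MvPolynomial.totalDegree_pow _ _).trans ?_
  refine (Nat.mul_le_mul_left _ ?_).trans_eq (mul_one _)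
  refine (MvPolynomial.totalDegree_add _ _).trans (max_le ?_ (MvPolynomial.totalDegree_X _).le)
  exact MvPolynomial.totalDegree_finsetSum_le fun i _ => (MvPolynomial.totalDegree_X _).le

/-- A polynomial of degree below `q - 1` sums to zero on every parametrized line. -/
theorem sum_eval_line_eq_zero [Fintype F] {σ : Type*} (P : MvPolynomial σ F)
    (hP : P.totalDegree < Fintype.card F - 1) (a x : σ → F) :
    ∑ c : F, MvPolynomial.eval (fun i => a i + c * x i) P = 0 := by
  set g : Polynomial F :=
    MvPolynomial.aeval (fun i => Polynomial.C (x i) * Polynomial.X + Polynomial.C (a i)) P with hg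
  have hdeg : g.natDegree < Fintype.card F - 1 := by
    refine lt_of_le_of_lt ?_ hP
    simpa using MvPolynomial.aeval_natDegree_le P le_rfl _
      fun i => Polynomial.natDegree_linear_le (a := x i) (b := a i)
  have heval : ∀ c, MvPolynomial.eval (fun i => a i + c * x i) P = g.eval c := by
    intro c
    rw [hg, MvPolynomial.aeval_def, ← Polynomial.coe_evalRingHom, MvPolynomial.hom_eval₂]
    rw [MvPolynomial.eval, MvPolynomial.coe_eval₂Hom]
    congr 1
    · ext; simp
    · ext i; simp; ring
  simp_rw [heval, Polynomial.eval_eq_sum_range]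
  rw [Finset.sum_comm]
  refine Finset.sum_eq_zero fun i hi => ?_
  rw [← Finset.mul_sum, FiniteField.sum_pow_lt_card_sub_one, mul_zero]
  have := Finset.mem_range.1 hi
  lia

/-- The coordinates of the `i`-th block of length `p`. -/
def block (p m i : ℕ) : Finset (Fin m) := {j | (j : ℕ) / p = i}

theorem card_block_le {p : ℕ} (hp : 0 < p) (m i : ℕ) : #(block p m i) ≤ p := by
  refine (Finset.card_le_card_of_injOn (s := block p m i) (t := Finset.range p)
    (fun j => (j : ℕ) % p) ?_ ?_).trans
    (Finset.card_range p).le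
  · intro j _; simpa using Nat.mod_lt _ hp
  · intro j hj j' hj' h
    simp only [block, coe_filter, mem_univ, true_and, Set.mem_ofPred_eq] at hj hj'
    ext
    rw [← Nat.div_add_mod (j : ℕ) p, ← Nat.div_add_mod (j' : ℕ) p, hj, hj']
    simpa using h

/-- The value of `P` on the `i`-th block of coordinates. -/
def blockEval {p : ℕ} (P : MvPolynomial (Fin p) F) {m : ℕ} (i : ℕ) (x : Fin m → F) : F :=
  MvPolynomial.eval (fun l : Fin p =>
    if h : p * i + (l : ℕ) < m then x ⟨p * i + (l : ℕ), h⟩ else 0) P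

theorem block_div_eq {p : ℕ} (i : ℕ) (l : Fin p) : (p * i + (l : ℕ)) / p = i := by
  rw [Nat.mul_add_div (l.pos), Nat.div_eq_of_lt l.2, add_zero]

theorem exists_blockEval_eq_zero [Fintype F] {p q s t : ℕ} {P : MvPolynomial (Fin p) F}
    {a : Fin (s + t) → F} (ha : a ∉ suppH P q s t) :
    ∃ i ∈ Finset.range (s / p), blockEval P i a = 0 := by
  by_contra! h
  exact ha ⟨0, by simp, by simpa [Hfun, blockEval] using Finset.prod_ne_zero_iff.2 h⟩

/-- Translating by `x` with the `i`-th block of `x` scaled by `c`. -/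
def shiftScale (p i : ℕ) {m : ℕ} (a x : Fin m → F) (c : F) : Fin m → F :=
  fun j => a j + if j ∈ block p m i then c * x j else x j

theorem sum_Hfun_shiftScale [Fintype F] [DecidableEq F] {p s t i : ℕ}
    {P : MvPolynomial (Fin p) F} (hdvd : p ∣ s)
    (hdeg : P.totalDegree < Fintype.card F - 1) (hi : i ∈ Finset.range (s / p))
    (e : Fin t → ℕ) {a : Fin (s + t) → F} (ha : blockEval P i a = 0) (x : Fin (s + t) → F) :
    ∑ c ∈ Finset.univ.erase (0 : F), Hfun P s t e (shiftScale p i a x c) = 0 := by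
  have hsp : ∀ j : Fin t, Fin.natAdd s j ∉ block p (s + t) i := by
    intro j hj
    simp only [block, mem_filter, mem_univ, true_and, Fin.val_natAdd, mem_range] at hj hi
    have : s / p ≤ (s + j) / p := Nat.div_le_div_right (by lia)
    lia
  have hlt : ∀ l : Fin p, p * i + (l : ℕ) < s + t := by
    intro l
    have h₁ : p * (i + 1) ≤ p * (s / p) := Nat.mul_le_mul_left _ (Finset.mem_range.1 hi)
    rw [Nat.mul_div_cancel' hdvd] at h₁
    have := l.2
    lia
  have hfact : ∀ c, Hfun P s t e (shiftScale p i a x c) =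
      MvPolynomial.eval (fun l : Fin p => a ⟨p * i + l, hlt l⟩ + c * x ⟨p * i + l, hlt l⟩) P *
        ((∏ k ∈ (Finset.range (s / p)).erase i, blockEval P k (a + x)) *
          ∏ j : Fin t, (a + x) (Fin.natAdd s j) ^ e j) := by
    intro c
    rw [Hfun, ← Finset.mul_prod_erase _ _ hi, mul_assoc]
    congr 2
    · congr 1
      funext l
      simp [shiftScale, block, hlt, block_div_eq]
    · refine Finset.prod_congr rfl fun k hk => ?_
      rw [blockEval]
      congr 2
      funext l
      simp [shiftScale, block, block_div_eq, Finset.ne_of_mem_erase hk]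
    · refine Finset.prod_congr rfl fun j _ => ?_
      simp [shiftScale, hsp]
  simp_rw [hfact]
  rw [← Finset.sum_mul]
  have h := sum_eval_line_eq_zero P hdeg (fun l : Fin p => a ⟨p * i + l, hlt l⟩)
    (fun l : Fin p => x ⟨p * i + l, hlt l⟩)
  rw [← Finset.add_sum_erase _ _ (mem_univ (0 : F))] at h
  have h₀ : MvPolynomial.eval
      (fun l : Fin p => a ⟨p * i + l, hlt l⟩ + 0 * x ⟨p * i + l, hlt l⟩) P = 0 := by
    simpa [blockEval, hlt] using ha
  rw [h₀, zero_add] at h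
  rw [h, zero_mul]

end TestPolynomial

section Pairing

variable {F : Type} [Field F] [Fintype F] {n m : ℕ}

theorem sum_pairing_line_eq (f : (Fin n → F) → F) (H : (Fin m → F) → F) (a : Fin m → F)
    (b : Fin n → F) (j : Fin m) (L U : Matrix (Fin n) (Fin m) F) :
    ∑ z : F, ip (fun x => f (b + z • U.col j + L.mulVec (x - a))) H =
      ∑ z : F, ip (fun x => f (b + z • U.col j + (L + colMask {j} U).mulVec (x - a))) H := by
  simp only [ip]
  rw [Finset.sum_comm, Finset.sum_comm (s := (Finset.univ : Finset F))]
  refine Finset.sum_congr rfl fun x _ => ?_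
  have hcol : (colMask {j} U).mulVec (x - a) = (x j - a j) • U.col j := by
    ext k
    simp [Matrix.mulVec, dotProduct, colMask, mul_comm]
  symm
  refine Fintype.sum_equiv (Equiv.addRight (x j - a j)) _ _ fun z => ?_
  rw [Matrix.add_mulVec, hcol]
  simp only [Equiv.coe_addRight, add_smul]
  congr 2
  abel

theorem sum_pairing_colScale_eq_zero [DecidableEq F] {p s t i : ℕ}
    {P : MvPolynomial (Fin p) F} (hdvd : p ∣ s)
    (hdeg : P.totalDegree < Fintype.card F - 1) (hi : i ∈ Finset.range (s / p))
    (e : Fin t → ℕ) {a : Fin (s + t) → F} (ha : blockEval P i a = 0)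
    (f : (Fin n → F) → F) (b : Fin n → F) (L : Matrix (Fin n) (Fin (s + t)) F) :
    ∑ c ∈ Finset.univ.erase (0 : F),
      ip (fun x => f (b + (colScale (block p (s + t) i) c L).mulVec (x - a)))
        (Hfun P s t e) = 0 := by
  have hsub : ∀ c ∈ Finset.univ.erase (0 : F),
      ip (fun x => f (b + (colScale (block p (s + t) i) c L).mulVec (x - a))) (Hfun P s t e) =
        ∑ w : Fin (s + t) → F,
          f (b + L.mulVec w) * Hfun P s t e (shiftScale p i a w c⁻¹) := by
    intro c hc
    have hc₀ : c ≠ 0 := by simpa using hc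
    symm
    refine Fintype.sum_bijective (fun w => shiftScale p i a w c⁻¹)
      (Finite.injective_iff_bijective.1 fun w w' h => ?_) _ _ fun w => ?_
    · funext j
      have hj := congrFun h j
      by_cases hmem : j ∈ block p (s + t) i <;> simpa [shiftScale, hmem, hc₀] using hj
    · dsimp only
      congr 3
      funext k
      simp only [Matrix.mulVec, dotProduct]
      refine Finset.sum_congr rfl fun j _ => ?_
      by_cases hmem : j ∈ block p (s + t) i
      · simp [shiftScale, colScale, hmem]
        field_simp
      · simp [shiftScale, colScale, hmem]
  rw [Finset.sum_congr rfl hsub, Finset.sum_comm]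
  refine Finset.sum_eq_zero fun w _ => ?_
  rw [← Finset.mul_sum]
  have h := sum_Hfun_shiftScale hdvd hdeg hi e ha w
  rw [← Finset.sum_nbij' (s := Finset.univ.erase (0 : F)) (fun c => c⁻¹) (fun c => c⁻¹)
    (f := fun c => Hfun P s t e (shiftScale p i a w c⁻¹)) (by simp) (by simp) (by simp) (by simp)
    (by simp)] at h
  rw [h, mul_zero]

end Pairing

section Density

variable {F : Type} [Field F] [Fintype F]

open Classical in
/-- The vector of all pairings of `f ∘ T` with the valid test polynomials. -/
def testVector {p : ℕ} (P : MvPolynomial (Fin p) F) (q s r t n : ℕ) (f : (Fin n → F) → F)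
    (T : Aff F n (s + t)) : (Fin t → ℕ) → F :=
  fun e => if validE q r t e then ip (fun x => f (affApp T x)) (Hfun P s t e) else 0

theorem rejects_iff_testVector_ne_zero {p : ℕ} (P : MvPolynomial (Fin p) F) (q s r t n : ℕ)
    (f : (Fin n → F) → F) (T : Aff F n (s + t)) :
    rejects P q s r t n f T ↔ testVector P q s r t n f T ≠ 0 := by
  rw [Function.ne_iff]
  refine exists_congr fun e => ?_
  by_cases h : validE q r t e <;> simp [testVector, h]

omit [Fintype F] in
theorem zoomIn_eq_range {n m : ℕ} (a : Fin m → F) (b : Fin n → F) :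
    {T : Aff F n m | affApp T a = b} =
      Set.range fun L : Matrix (Fin n) (Fin m) F => (L, b - L.mulVec a) := by
  ext ⟨L, c⟩
  constructor
  · rintro rfl
    exact ⟨L, by simp [affApp]⟩
  · rintro ⟨L, h⟩
    obtain ⟨rfl, rfl⟩ := Prod.mk.inj h
    simp [affApp]

/-- Outside the support of the test polynomials, zooming in increases the rejection
probability by a factor of at most `2 p q²`. -/
theorem dens_zoomIn_le {p q s r t n : ℕ} (hp : 0 < p) (hq : Fintype.card F = q)
    {P : MvPolynomial (Fin p) F} (hdvd : p ∣ s) (hdeg : P.totalDegree < q - 1)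
    (f : (Fin n → F) → F) {a : Fin (s + t) → F} (ha : a ∉ suppH P q s t) (b : Fin n → F) :
    dens {T : Aff F n (s + t) | rejects P q s r t n f T} {T | affApp T a = b} ≤
      2 * p * q ^ 2 * mu {T : Aff F n (s + t) | rejects P q s r t n f T} := by
  classical
  obtain ⟨i, hi, hai⟩ := exists_blockEval_eq_zero ha
  subst hq
  set R : Set (Aff F n (s + t)) := {T | rejects P (Fintype.card F) s r t n f T} with hR
  set Φ : Matrix (Fin n) (Fin (s + t)) F → (Fin n → F) → (Fin t → ℕ) → F :=
    fun L c => testVector P (Fintype.card F) s r t n f (L, c - L.mulVec a) with hΦ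
  have hmem : ∀ L c, (L, c - L.mulVec a) ∈ R ↔ Φ L c ≠ 0 := fun L c =>
    rejects_iff_testVector_ne_zero ..
  have hmain := card_ne_zero_le Φ b (block p (s + t) i) (fun j _ L U => by
      ext e
      by_cases he : validE (Fintype.card F) r t e
      · simpa [hΦ, testVector, he, affApp_shift] using
          sum_pairing_line_eq f (Hfun P s t e) a b j L U
      · simp [hΦ, testVector, he]) (fun L => by
      ext e
      by_cases he : validE (Fintype.card F) r t e
      · simpa only [hΦ, testVector, he, affApp_shift, Finset.sum_apply, if_true, Pi.zero_apply] using
          sum_pairing_colScale_eq_zero hdvd hdeg hi e hai f b L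
      · simp [hΦ, testVector, he])
  have hC : Nat.card {T : Aff F n (s + t) | affApp T a = b} =
      Fintype.card (Matrix (Fin n) (Fin (s + t)) F) := by
    rw [zoomIn_eq_range, Nat.card_range_of_injective fun L L' h => (Prod.mk.inj h).1,
      Nat.card_eq_fintype_card]
  have hRC : Nat.card ↥(R ∩ {T : Aff F n (s + t) | affApp T a = b}) ≤
      #{L : Matrix (Fin n) (Fin (s + t)) F | Φ L b ≠ 0} := by
    rw [Nat.card_coe_set_eq, ← Set.ncard_coe_finset]
    refine Set.ncard_le_ncard_of_injOn Prod.fst ?_ ?_ (Finset.finite_toSet _)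
    · rw [zoomIn_eq_range]
      rintro _ ⟨h, L, rfl⟩
      simpa using (hmem L b).1 h
    · rw [zoomIn_eq_range]
      rintro _ ⟨-, L, rfl⟩ _ ⟨-, L', rfl⟩ (rfl : L = L')
      rfl
  have hbad : #{x : Matrix (Fin n) (Fin (s + t)) F × (Fin n → F) | Φ x.1 x.2 ≠ 0} ≤
      Nat.card ↥R := by
    rw [Nat.card_coe_set_eq, ← Set.ncard_coe_finset]
    refine Set.ncard_le_ncard_of_injOn (fun x => (x.1, x.2 - x.1.mulVec a)) ?_ ?_ (Set.toFinite _)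
    · rintro ⟨L, c⟩ h
      exact (hmem L c).2 (by simpa using h)
    · rintro ⟨L, c⟩ - ⟨L', c'⟩ - h
      obtain ⟨rfl, h₂⟩ := Prod.mk.inj h
      simpa using h₂
  have hcount : Nat.card ↥(R ∩ {T : Aff F n (s + t) | affApp T a = b}) *
      Fintype.card (Fin n → F) ≤ 2 * p * Fintype.card F ^ 2 * Nat.card ↥R := by
    refine (Nat.mul_le_mul_right _ hRC).trans (hmain.trans ?_)
    gcongr
    exact card_block_le hp _ _
  have hK : (0 : ℝ) < Fintype.card (Matrix (Fin n) (Fin (s + t)) F) := by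
    exact_mod_cast Fintype.card_pos
  have hN : (0 : ℝ) < Fintype.card (Fin n → F) := by exact_mod_cast Fintype.card_pos
  have hcount' : (Nat.card ↥(R ∩ {T : Aff F n (s + t) | affApp T a = b}) : ℝ) *
      Fintype.card (Fin n → F) ≤ 2 * p * (Fintype.card F : ℝ) ^ 2 * Nat.card ↥R := by
    exact_mod_cast hcount
  rw [_root_.dens, mu, hC, Nat.card_eq_fintype_card (α := Aff F n (s + t)), Fintype.card_prod,
    Nat.cast_mul, ← mul_div_assoc, div_le_div_iff₀ hK (by positivity)]
  calc _ = (Nat.card ↥(R ∩ {T : Aff F n (s + t) | affApp T a = b}) : ℝ) *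
      Fintype.card (Fin n → F) * Fintype.card (Matrix (Fin n) (Fin (s + t)) F) := by ring
    _ ≤ _ := by gcongr

omit [Fintype F] in
/-- For `p = q = 2` the polynomial `P` has no zeros. -/
theorem eval_ne_zero_of_two {P : MvPolynomial (Fin 2) F} (hP : Pdef 2 2 two_pos P)
    (x : Fin 2 → F) : MvPolynomial.eval x P ≠ 0 := by
  have h1 : MvPolynomial.eval ![1, 0] P = 1 := by
    have h := congrArg (MvPolynomial.eval ![(1 : F), 0]) hP
    have huniv : (Finset.univ : Finset (Finset (Fin (2 - 1)))) = {∅, {0}} := by decide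
    rw [huniv, Finset.sum_pair (by decide)] at h
    simpa using h
  have hP₀ : P ≠ 0 := by rintro rfl; simp at h1
  have hdeg := hP.totalDegree_add_le hP₀
  obtain h := MvPolynomial.totalDegree_eq_zero_iff_eq_C.1 (by lia : P.totalDegree = 0)
  rw [h, MvPolynomial.eval_C] at h1 ⊢
  simp [h1]

theorem two_mul_mul_rpow_lt {p q t : ℕ} {M : ℝ} (hM : 1000 ≤ M) (hp : 2 ≤ p) (hpq : p ≤ q)
    (hq : 3 ≤ q) (ht : t = max (p + 2) 10) :
    2 * (p : ℝ) * (q : ℝ) ^ 2 * (q : ℝ) ^ (-M) <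
      1 - 1 / ((q : ℝ) - 1) ^ 2 - 1 / (q : ℝ) ^ 6 -
          2000 * (t : ℝ) * (q : ℝ) ^ 200 * (q : ℝ) ^ (-(M / 4)) := by
  have hq3 : (3 : ℝ) ≤ q := by exact_mod_cast hq
  have hpq' : (p : ℝ) ≤ q := by exact_mod_cast hpq
  have ht' : (t : ℝ) ≤ 10 * q := by
    have : t ≤ 10 * q := by lia
    exact_mod_cast this
  have hpow : (q : ℝ) ^ (-(M / 4)) ≤ ((q : ℝ) ^ 250)⁻¹ := by
    rw [← Real.rpow_natCast, ← Real.rpow_neg (by positivity)]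
    exact Real.rpow_le_rpow_of_exponent_le (by linarith) (by push_cast; linarith)
  have hpow' : (q : ℝ) ^ (-M) ≤ ((q : ℝ) ^ 250)⁻¹ :=
    (Real.rpow_le_rpow_of_exponent_le (by linarith) (by linarith)).trans hpow
  have h49 : ((q : ℝ) ^ 49)⁻¹ ≤ ((3 : ℝ) ^ 49)⁻¹ := by gcongr
  have h247 : ((q : ℝ) ^ 247)⁻¹ ≤ ((3 : ℝ) ^ 49)⁻¹ := by
    refine le_trans ?_ h49
    gcongr
    · linarith
    · norm_num
  have hA : 2 * (p : ℝ) * (q : ℝ) ^ 2 * (q : ℝ) ^ (-M) ≤ 2 * ((3 : ℝ) ^ 49)⁻¹ := by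
    calc _ ≤ 2 * (q : ℝ) * (q : ℝ) ^ 2 * ((q : ℝ) ^ 250)⁻¹ := by gcongr
      _ = 2 * ((q : ℝ) ^ 247)⁻¹ := by field_simp
      _ ≤ _ := by gcongr
  have hB : 2000 * (t : ℝ) * (q : ℝ) ^ 200 * (q : ℝ) ^ (-(M / 4)) ≤
      20000 * ((3 : ℝ) ^ 49)⁻¹ := by
    calc _ ≤ 2000 * (10 * (q : ℝ)) * (q : ℝ) ^ 200 * ((q : ℝ) ^ 250)⁻¹ := by gcongr
      _ = 20000 * ((q : ℝ) ^ 49)⁻¹ := by field_simp; norm_num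
      _ ≤ _ := by gcongr
  have hC : 1 / ((q : ℝ) - 1) ^ 2 ≤ 1 / 2 ^ 2 := by
    gcongr; linarith
  have hD : 1 / (q : ℝ) ^ 6 ≤ 1 / 3 ^ 6 := by gcongr
  norm_num at hA hB hC hD ⊢
  linarith

end Density

/-- There is an absolute constant `M₀` such that for all `M ≥ M₀`: if
`μ(S_t) ≤ q^{-M}` then for every `a ∉ supp(H)` and every `b`, the density of `S_t` in the
zoom-in `C_{a,b}` is strictly below `1 - 1/(q-1)² - 1/q⁶ - 2000·t·q^{200}·q^{-M/4}`. -/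
theorem not_dense_outside_support :
    ∃ M₀ : ℝ, ∀ M : ℝ, M₀ ≤ M →
    ∀ (p k : ℕ) (hp : p.Prime), 1 ≤ k →
    ∀ (F : Type) [Field F] [Fintype F],
    ∀ q : ℕ, q = p ^ k → Fintype.card F = q →
    ∀ d s r : ℕ, p ∣ s → 0 < r → r ≤ p * (q - q / p) → d + 1 = s * (q - q / p) + r →
    ∀ t : ℕ, t = max (p + 2) 10 →
    ∀ P : MvPolynomial (Fin p) F, Pdef p q hp.pos P →
    ∀ n : ℕ, s + t + 110 ≤ n →
    ∀ f : (Fin n → F) → F,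
      mu {T : Aff F n (s + t) | rejects P q s r t n f T} ≤ (q : ℝ) ^ (-M) →
    ∀ a : Fin (s + t) → F, a ∉ suppH P q s t →
    ∀ b : Fin n → F,
      dens {T : Aff F n (s + t) | rejects P q s r t n f T}
          {T : Aff F n (s + t) | affApp T a = b} <
        1 - 1 / ((q : ℝ) - 1) ^ 2 - 1 / (q : ℝ) ^ 6 -
          2000 * (t : ℝ) * (q : ℝ) ^ 200 * (q : ℝ) ^ (-(M / 4)) := by
  refine ⟨1000, ?_⟩
  intro M hM p k hp hk F _ _ q hqpk hcard d s r hdvd hr _ _ t ht P hP n _ f hmu a ha b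
  have hpq : p ≤ q := hqpk ▸ Nat.le_self_pow (by lia) p
  have hp2 := hp.two_le
  obtain hq2 | hq3 : q = 2 ∨ 3 ≤ q := by lia
  · obtain rfl : p = 2 := by lia
    subst hq2
    obtain ⟨i, -, hi⟩ := exists_blockEval_eq_zero ha
    exact absurd hi (eval_ne_zero_of_two hP _)
  · have hdeg : P.totalDegree < q - 1 := by
      by_cases hP₀ : P = 0
      · simp only [hP₀, MvPolynomial.totalDegree_zero]
        lia
      · have := hP.totalDegree_add_le hP₀
        lia
    calc _ ≤ 2 * (p : ℝ) * (q : ℝ) ^ 2 *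
          mu {T : Aff F n (s + t) | rejects P q s r t n f T} :=
          dens_zoomIn_le hp.pos hcard hdvd hdeg f ha b
      _ ≤ 2 * (p : ℝ) * (q : ℝ) ^ 2 * (q : ℝ) ^ (-M) := by gcongr
      _ < _ := two_mul_mul_rpow_lt hM hp2 hpq hq3 ht

end
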